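/- arXiv:1603.06037 — 2 statements merged into one kernel-verified Lean document; each statement's English description precedes it below -/
import Mathlib

section
/- For every γ ∈ (-3, 1] and every real β ≥ 0, there is a constant C (depending only on γ, β) such that for all v ∈ ℝ³: ∫_{ℝ³} |v-η|^γ e^{-|v|²/4} e^{-|η|²/4} (1+|v|²)^{β/2} (1+|η|²)^{-β/2} dη ≤ C (1+|v|)^{-1}. -/
open Real MeasureTheory

theorem exists_rpow_mul_exp_neg_div_four_le (p : ℝ) :
    ∃ M : ℝ, 0 < M ∧ ∀ t : ℝ, 1 ≤ t → t ^ p * exp (-t / 4) ≤ M := by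
  obtain ⟨n, hn⟩ := exists_nat_ge p
  refine ⟨4 ^ n * n.factorial, by positivity, fun t ht ↦ ?_⟩
  have hexp := Real.pow_div_factorial_le_exp (x := t / 4) (by linarith) n
  rw [div_le_iff₀ (by positivity), div_pow, div_le_iff₀ (by positivity)] at hexp
  calc t ^ p * exp (-t / 4) ≤ t ^ n * exp (-t / 4) := by
        gcongr
        exact_mod_cast Real.rpow_le_rpow_of_exponent_le ht hn
    _ ≤ exp (t / 4) * n.factorial * 4 ^ n * exp (-t / 4) := by gcongr
    _ = 4 ^ n * n.factorial * (exp (t / 4) * exp (-t / 4)) := by ring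
    _ = 4 ^ n * n.factorial := by
        rw [← Real.exp_add, neg_div, add_neg_cancel, Real.exp_zero, mul_one]

theorem exists_exp_neg_mul_rpow_mul_sq_le (β : ℝ) :
    ∃ M : ℝ, 0 < M ∧ ∀ r : ℝ, 0 ≤ r →
      exp (-r ^ 2 / 4) * (1 + r ^ 2) ^ (β / 2) * (1 + r) ^ 2 ≤ M := by
  obtain ⟨M, hM, h⟩ := exists_rpow_mul_exp_neg_div_four_le (β / 2 + 1)
  refine ⟨2 * exp (1 / 4) * M, by positivity, fun r _ ↦ ?_⟩
  have hexp : exp (-r ^ 2 / 4) = exp (1 / 4) * exp (-(1 + r ^ 2) / 4) := by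
    rw [← Real.exp_add]
    ring_nf
  calc exp (-r ^ 2 / 4) * (1 + r ^ 2) ^ (β / 2) * (1 + r) ^ 2
      ≤ exp (-r ^ 2 / 4) * (1 + r ^ 2) ^ (β / 2) * (2 * (1 + r ^ 2)) := by
        gcongr
        nlinarith [sq_nonneg (1 - r)]
    _ = 2 * exp (1 / 4) * ((1 + r ^ 2) ^ (β / 2 + 1) * exp (-(1 + r ^ 2) / 4)) := by
        rw [hexp, Real.rpow_add_one (by positivity)]
        ring
    _ ≤ 2 * exp (1 / 4) * M := by
        gcongr
        exact h _ (by nlinarith [sq_nonneg r])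

theorem integrable_indicator_ball_norm_rpow {γ : ℝ} (hγ : -3 < γ) :
    Integrable ((Metric.ball (0 : EuclideanSpace ℝ (Fin 3)) 1).indicator fun x ↦ ‖x‖ ^ γ) := by
  rw [integrable_indicator_iff measurableSet_ball]
  refine integrableOn_ball_of_norm_le_rpow (C := 1) (α := -γ) (by simp)
    (by simp; linarith) (ae_of_all _ fun x ↦ ?_)
    (by fun_prop : Measurable fun x : EuclideanSpace ℝ (Fin 3) ↦ ‖x‖ ^ γ).aestronglyMeasurable
  rw [neg_neg, one_mul, Real.norm_of_nonneg (by positivity)]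

theorem integrable_one_add_norm_mul_exp_neg_sq :
    Integrable fun η : EuclideanSpace ℝ (Fin 3) ↦ (1 + ‖η‖) * exp (-‖η‖ ^ 2 / 4) := by
  rw [integrable_fun_norm_addHaar volume (f := fun r ↦ (1 + r) * exp (-r ^ 2 / 4))]
  have h (n : ℕ) : IntegrableOn (fun x : ℝ ↦ x ^ (n : ℝ) * exp (-(1 / 4) * x ^ 2)) (Set.Ioi 0) :=
    integrableOn_rpow_mul_exp_neg_mul_sq (by norm_num)
      (by linarith [(Nat.cast_nonneg n : (0 : ℝ) ≤ n)])
  refine ((h 2).add (h 3)).congr_fun (fun x _ ↦ ?_) measurableSet_Ioi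
  have hexp : -(1 / 4) * x ^ 2 = -x ^ 2 / 4 := by ring
  simp only [Pi.add_apply, Real.rpow_natCast, finrank_euclideanSpace_fin, smul_eq_mul, hexp]
  ring

theorem norm_sub_rpow_mul_exp_le {γ : ℝ} (hγ : γ ≤ 1) (v η : EuclideanSpace ℝ (Fin 3)) :
    ‖v - η‖ ^ γ * exp (-‖η‖ ^ 2 / 4) ≤
      (Metric.ball (0 : EuclideanSpace ℝ (Fin 3)) 1).indicator (fun x ↦ ‖x‖ ^ γ) (v - η)
        + (1 + ‖v‖) * ((1 + ‖η‖) * exp (-‖η‖ ^ 2 / 4)) := by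
  by_cases h : ‖v - η‖ < 1
  · rw [Set.indicator_of_mem (by simpa using h)]
    have hexp : exp (-‖η‖ ^ 2 / 4) ≤ 1 :=
      Real.exp_le_one_iff.2 (by nlinarith [sq_nonneg ‖η‖])
    have := mul_le_of_le_one_right (a := ‖v - η‖ ^ γ) (by positivity) hexp
    have : 0 ≤ (1 + ‖v‖) * ((1 + ‖η‖) * exp (-‖η‖ ^ 2 / 4)) := by positivity
    linarith
  · rw [Set.indicator_of_notMem (by simpa using h), zero_add, ← mul_assoc]
    gcongr
    calc ‖v - η‖ ^ γ ≤ ‖v - η‖ ^ (1 : ℝ) :=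
          Real.rpow_le_rpow_of_exponent_le (not_lt.1 h) hγ
      _ = ‖v - η‖ := Real.rpow_one _
      _ ≤ ‖v‖ + ‖η‖ := norm_sub_le _ _
      _ ≤ (1 + ‖v‖) * (1 + ‖η‖) := by
          nlinarith [mul_nonneg (norm_nonneg v) (norm_nonneg η)]

theorem stmt_7 (γ β : ℝ) (hγ1 : -3 < γ) (hγ2 : γ ≤ 1) (hβ : 0 ≤ β) :
    ∃ C : ℝ, 0 < C ∧ ∀ v : EuclideanSpace ℝ (Fin 3),
      (∫ η : EuclideanSpace ℝ (Fin 3),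
          ‖v - η‖ ^ γ * Real.exp (-‖v‖ ^ 2 / 4) * Real.exp (-‖η‖ ^ 2 / 4)
            * (1 + ‖v‖ ^ 2) ^ (β / 2) * (1 + ‖η‖ ^ 2) ^ (-β / 2))
        ≤ C * (1 + ‖v‖)⁻¹ := by
  obtain ⟨M, hM, hMle⟩ := exists_exp_neg_mul_rpow_mul_sq_le β
  set S := (Metric.ball (0 : EuclideanSpace ℝ (Fin 3)) 1).indicator fun x ↦ ‖x‖ ^ γ
  set G := fun η : EuclideanSpace ℝ (Fin 3) ↦ (1 + ‖η‖) * exp (-‖η‖ ^ 2 / 4)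
  have hSint : Integrable S := integrable_indicator_ball_norm_rpow hγ1
  have hGint : Integrable G := integrable_one_add_norm_mul_exp_neg_sq
  have hS0 : 0 ≤ ∫ x, S x :=
    integral_nonneg (Set.indicator_nonneg fun x _ ↦ by positivity)
  have hG0 : 0 ≤ ∫ x, G x := integral_nonneg fun x ↦ by positivity
  refine ⟨M * (1 + (∫ x, S x) + ∫ x, G x), by positivity, fun v ↦ ?_⟩
  set K := exp (-‖v‖ ^ 2 / 4) * (1 + ‖v‖ ^ 2) ^ (β / 2) with hK
  have hK0 : 0 ≤ K := by positivity
  have hSv : Integrable fun η ↦ S (v - η) := hSint.comp_sub_left v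
  have hGv : Integrable fun η ↦ (1 + ‖v‖) * G η := hGint.const_mul _
  calc _ ≤ ∫ η, K * (S (v - η) + (1 + ‖v‖) * G η) := by
        refine integral_mono_of_nonneg (ae_of_all _ fun η ↦ by positivity)
          ((hSv.add hGv).const_mul K) (ae_of_all _ fun η ↦ ?_)
        have hweight : (1 + ‖η‖ ^ 2) ^ (-β / 2) ≤ 1 :=
          Real.rpow_le_one_of_one_le_of_nonpos (by nlinarith [sq_nonneg ‖η‖]) (by linarith)
        calc _ ≤ ‖v - η‖ ^ γ * exp (-‖v‖ ^ 2 / 4) * exp (-‖η‖ ^ 2 / 4)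
              * (1 + ‖v‖ ^ 2) ^ (β / 2) := mul_le_of_le_one_right (by positivity) hweight
          _ = K * (‖v - η‖ ^ γ * exp (-‖η‖ ^ 2 / 4)) := by rw [hK]; ring
          _ ≤ _ := mul_le_mul_of_nonneg_left (norm_sub_rpow_mul_exp_le hγ2 v η) hK0
    _ = K * ((∫ x, S x) + (1 + ‖v‖) * ∫ x, G x) := by
        rw [integral_const_mul, integral_add hSv hGv, integral_const_mul,
          integral_sub_left_eq_self S volume v]
    _ ≤ K * ((1 + ‖v‖) * (1 + (∫ x, S x) + ∫ x, G x)) := by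
        gcongr
        nlinarith [norm_nonneg v, mul_nonneg (norm_nonneg v) hS0]
    _ = K * (1 + ‖v‖) ^ 2 * (1 + (∫ x, S x) + ∫ x, G x) * (1 + ‖v‖)⁻¹ := by
        field_simp
    _ ≤ M * (1 + (∫ x, S x) + ∫ x, G x) * (1 + ‖v‖)⁻¹ := by
        gcongr
        exact hMle _ (norm_nonneg v)
end

section
/- Let γ ∈ (-3, 1]. There exists C > 0 such that for all v ∈ ℝ³, ∫_{ℝ³} |v-η|^{-(3-γ)/2} e^{-|v-η|²/8} e^{-(|v|²-|η|²)²/(8|v-η|²)} dη ≤ C (1+|v|)^{-1}. -/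
open Real MeasureTheory

/-- Any vector is a nonnegative multiple of the first vector of some orthonormal basis. -/
theorem exists_orthonormalBasis_norm_smul (v : EuclideanSpace ℝ (Fin 3)) :
    ∃ b : OrthonormalBasis (Fin 3) ℝ (EuclideanSpace ℝ (Fin 3)), v = ‖v‖ • b 0 := by
  by_cases hv : v = 0
  · exact ⟨EuclideanSpace.basisFun _ _, by simp [hv]⟩
  have hn : ‖v‖ ≠ 0 := norm_ne_zero_iff.mpr hv
  have ho : Orthonormal ℝ (({0} : Set (Fin 3)).domRestrict fun _ => ‖v‖⁻¹ • v) := by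
    refine ⟨fun i => ?_, fun i j hij => absurd (Subsingleton.elim i j) hij⟩
    simp [norm_smul, hn]
  obtain ⟨b, hb⟩ := ho.exists_orthonormalBasis_extension_of_card_eq (by simp)
  refine ⟨b, ?_⟩
  rw [hb 0 rfl, smul_smul, mul_inv_cancel₀ hn, one_smul]

theorem lintegral_euclideanSpace_fin_three {f : EuclideanSpace ℝ (Fin 3) → ENNReal}
    (hf : Measurable f) :
    ∫⁻ x, f x = ∫⁻ s : ℝ, ∫⁻ y : ℝ × ℝ, f !₂[s, y.1, y.2] := by
  have h1 := (PiLp.volume_preserving_toLp (Fin 3)).lintegral_comp hf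
  have h2 := (volume_preserving_piFinSuccAbove (fun _ : Fin 3 => ℝ) 0).symm.lintegral_comp
    (f := fun x => f (WithLp.toLp 2 x)) (hf.comp (by fun_prop))
  have h3 := ((MeasurePreserving.id (volume : Measure ℝ)).prod
    (volume_preserving_finTwoArrow ℝ).symm).lintegral_comp
    (f := fun x => f (WithLp.toLp 2 ((MeasurableEquiv.piFinSuccAbove (fun _ : Fin 3 => ℝ) 0).symm x)))
    (hf.comp (by fun_prop))
  rw [← h1, ← h2]
  refine h3.symm.trans ?_
  rw [lintegral_prod _ (by
    refine (hf.comp ?_).aemeasurable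
    fun_prop)]
  refine lintegral_congr fun s => lintegral_congr fun y => ?_
  congr 2
  ext i
  fin_cases i <;> rfl

/-- Integration over the plane of a radial function, with the radius shifted by a height `s`. -/
theorem lintegral_plane_sqrt_le (s : ℝ) {g : ℝ → ENNReal} (hg : Measurable g) :
    ∫⁻ y : ℝ × ℝ, g √(s ^ 2 + y.1 ^ 2 + y.2 ^ 2) ≤
      ENNReal.ofReal (2 * π) * ∫⁻ r in Set.Ioi |s|, ENNReal.ofReal r * g r := by
  have hpos : ∀ x ∈ Set.Ioi (0 : ℝ), 0 < s ^ 2 + x ^ 2 := fun x hx => by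
    have : 0 < x := hx
    positivity
  have key := lintegral_image_eq_lintegral_abs_deriv_mul (s := Set.Ioi (0 : ℝ))
    (f := fun ρ => √(s ^ 2 + ρ ^ 2)) (f' := fun ρ => ρ / √(s ^ 2 + ρ ^ 2))
    measurableSet_Ioi (fun x hx => by
      have h := (((hasDerivAt_id x).pow 2).const_add (s ^ 2)).sqrt (hpos x hx).ne'
      refine (h.congr_deriv ?_).hasDerivWithinAt
      simp
      field_simp) (fun x hx y hy hxy => by
      have hx' : 0 < x := hx
      have hy' : 0 < y := hy
      have := (Real.sqrt_inj (hpos x hx).le (hpos y hy).le).mp hxy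
      nlinarith) (fun r => ENNReal.ofReal r * g r)
  have hsub : (fun ρ => √(s ^ 2 + ρ ^ 2)) '' Set.Ioi (0 : ℝ) ⊆ Set.Ioi |s| := by
    rintro _ ⟨x, hx, rfl⟩
    have hx' : 0 < x := hx
    refine Real.lt_sqrt_of_sq_lt ?_
    rw [sq_abs]
    nlinarith
  rw [← lintegral_comp_polarCoord_symm]
  have htarget : polarCoord.target = Set.Ioi (0 : ℝ) ×ˢ Set.Ioo (-π) π := rfl
  rw [htarget, Measure.volume_eq_prod, ← Measure.prod_restrict]
  calc
    _ = ∫⁻ p, ENNReal.ofReal p.1 * g √(s ^ 2 + p.1 ^ 2) * 1 ∂((volume.restrict (Set.Ioi (0 : ℝ))).prod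
          (volume.restrict (Set.Ioo (-π) π))) := by
      refine lintegral_congr fun p => ?_
      rw [mul_one, smul_eq_mul]
      congr 3
      change s ^ 2 + (p.1 * cos p.2) ^ 2 + (p.1 * sin p.2) ^ 2 = _
      linear_combination p.1 ^ 2 * Real.sin_sq_add_cos_sq p.2
    _ = (∫⁻ ρ in Set.Ioi (0 : ℝ), ENNReal.ofReal ρ * g √(s ^ 2 + ρ ^ 2)) *
          ∫⁻ _ in Set.Ioo (-π) π, 1 :=
      lintegral_prod_mul (f := fun ρ : ℝ => ENNReal.ofReal ρ * g √(s ^ 2 + ρ ^ 2))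
        (g := fun _ : ℝ => 1) (by fun_prop) (by fun_prop)
    _ = ENNReal.ofReal (2 * π) *
          ∫⁻ r in (fun ρ => √(s ^ 2 + ρ ^ 2)) '' Set.Ioi (0 : ℝ), ENNReal.ofReal r * g r := by
      rw [key, mul_comm]
      congr 1
      · simp [two_mul]
      · refine setLIntegral_congr_fun measurableSet_Ioi fun x hx => ?_
        have hx' : 0 < x := hx
        have hs : 0 < √(s ^ 2 + x ^ 2) := Real.sqrt_pos.mpr (hpos x hx)
        rw [← mul_assoc, ← ENNReal.ofReal_mul (abs_nonneg _), abs_of_pos (by positivity),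
          div_mul_cancel₀ _ hs.ne']
    _ ≤ _ := by gcongr

/-- In cylindrical coordinates around a unit vector, Lebesgue measure on `ℝ³` is
`2π r dr ds` in the height `s` and the distance `r > |s|` to the origin. -/
theorem lintegral_inner_norm_le (b : OrthonormalBasis (Fin 3) ℝ (EuclideanSpace ℝ (Fin 3)))
    {F : ℝ → ℝ → ENNReal} (hF : Measurable fun p : ℝ × ℝ => F p.1 p.2) :
    ∫⁻ u : EuclideanSpace ℝ (Fin 3), F (inner ℝ (b 0) u) ‖u‖ ≤
      ENNReal.ofReal (2 * π) *
        ∫⁻ r in Set.Ioi (0 : ℝ), ENNReal.ofReal r * ∫⁻ s in Set.Ioo (-r) r, F s r := by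
  have hm : Measurable fun u : EuclideanSpace ℝ (Fin 3) => F (inner ℝ (b 0) u) ‖u‖ :=
    hF.comp (f := fun u : EuclideanSpace ℝ (Fin 3) => (inner ℝ (b 0) u, ‖u‖)) (by fun_prop)
  have hm' : Measurable fun u : EuclideanSpace ℝ (Fin 3) => F (u 0) ‖u‖ :=
    hF.comp (f := fun u : EuclideanSpace ℝ (Fin 3) => (u 0, ‖u‖)) (by fun_prop)
  rw [← b.measurePreserving_repr_symm.lintegral_comp hm]
  have h0 : ∀ u, F (inner ℝ (b 0) (b.repr.symm u)) ‖b.repr.symm u‖ = F (u 0) ‖u‖ := fun u => by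
    rw [← b.repr_apply_apply, LinearIsometryEquiv.apply_symm_apply, LinearIsometryEquiv.norm_map]
  simp_rw [h0]
  rw [lintegral_euclideanSpace_fin_three hm']
  have hG : Measurable fun p : ℝ × ℝ =>
      (Set.Ioi |p.1|).indicator (fun r => ENNReal.ofReal r * F p.1 r) p.2 := by
    have : MeasurableSet {p : ℝ × ℝ | |p.1| < p.2} := measurableSet_lt (by fun_prop) (by fun_prop)
    exact (show Measurable fun p : ℝ × ℝ => ENNReal.ofReal p.2 * F p.1 p.2 by fun_prop).indicator this
  calc
    _ = ∫⁻ s : ℝ, ∫⁻ y : ℝ × ℝ, F s √(s ^ 2 + y.1 ^ 2 + y.2 ^ 2) := by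
      refine lintegral_congr fun s => lintegral_congr fun y => ?_
      simp [EuclideanSpace.norm_eq, Fin.sum_univ_three]
    _ ≤ ∫⁻ s : ℝ, ENNReal.ofReal (2 * π) * ∫⁻ r in Set.Ioi |s|, ENNReal.ofReal r * F s r :=
      lintegral_mono fun s => lintegral_plane_sqrt_le s
        (hF.comp (f := fun r : ℝ => (s, r)) (by fun_prop))
    _ = ENNReal.ofReal (2 * π) * ∫⁻ s : ℝ, ∫⁻ r : ℝ,
          (Set.Ioi |s|).indicator (fun r => ENNReal.ofReal r * F s r) r := by
      rw [lintegral_const_mul' _ _ ENNReal.ofReal_ne_top]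
      simp_rw [lintegral_indicator measurableSet_Ioi]
    _ = ENNReal.ofReal (2 * π) * ∫⁻ r : ℝ, ∫⁻ s : ℝ,
          (Set.Ioi |s|).indicator (fun r => ENNReal.ofReal r * F s r) r := by
      rw [lintegral_lintegral_swap hG.aemeasurable]
    _ = _ := by
      rw [← lintegral_indicator measurableSet_Ioi]
      congr 1
      refine lintegral_congr fun r => ?_
      by_cases hr : 0 < r
      · rw [Set.indicator_of_mem (Set.mem_Ioi.mpr hr), ← lintegral_const_mul' _ _ ENNReal.ofReal_ne_top,
          ← lintegral_indicator measurableSet_Ioo]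
        refine lintegral_congr fun s => ?_
        simp only [Set.indicator_apply, Set.mem_Ioi, Set.mem_Ioo, abs_lt]
      · rw [Set.indicator_of_notMem (by simpa using hr)]
        refine (lintegral_congr fun s => ?_).trans lintegral_zero
        refine Set.indicator_of_notMem (fun h => hr ?_) _
        exact (abs_nonneg s).trans_lt h

theorem lintegral_Ioo_exp_neg_sq_le {c r : ℝ} (hc : 0 ≤ c) (hr : 0 < r) :
    ∫⁻ s in Set.Ioo (-r) r, ENNReal.ofReal (exp (-(2 * (c * s) - r ^ 2) ^ 2 / (8 * r ^ 2))) ≤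
      ENNReal.ofReal ((2 + √(2 * π)) * r * (1 + c)⁻¹) := by
  set φ : ℝ → ℝ := fun s => exp (-(2 * (c * s) - r ^ 2) ^ 2 / (8 * r ^ 2)) with hφ
  have hφ_le : ∀ s, φ s ≤ 1 := fun s => by
    rw [hφ]
    refine exp_le_one_iff.mpr (div_nonpos_of_nonpos_of_nonneg ?_ (by positivity))
    nlinarith [sq_nonneg (2 * (c * s) - r ^ 2)]
  have hint : IntegrableOn φ (Set.Ioo (-r) r) :=
    ((by fun_prop : Continuous φ).integrableOn_Icc (a := -r) (b := r)).mono_set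
      Set.Ioo_subset_Icc_self
  rw [← ofReal_integral_eq_lintegral_ofReal hint (ae_of_all _ fun s => (exp_pos _).le)]
  refine ENNReal.ofReal_le_ofReal ?_
  set J := ∫ s in Set.Ioo (-r) r, φ s with hJ
  have hJ1 : J ≤ 2 * r := by
    calc J ≤ ∫ s in Set.Ioo (-r) r, (1 : ℝ) :=
          integral_mono hint (integrable_const _) hφ_le
      _ = 2 * r := by
          simp [measureReal_def, hr.le, two_mul]
  have hJ2 : c * J ≤ √(2 * π) * r := by
    rcases hc.eq_or_lt with rfl | hc
    · simp; positivity
    have hb : 0 < c ^ 2 / (2 * r ^ 2) := by positivity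
    have hφ' : φ = fun s => (fun x => exp (-(c ^ 2 / (2 * r ^ 2)) * x ^ 2)) (s - r ^ 2 / (2 * c)) := by
      funext s
      simp only [hφ]
      congr 1
      field_simp
      ring
    have hint' : Integrable φ := by
      rw [hφ']
      exact (integrable_exp_neg_mul_sq hb).comp_sub_right _
    have htot : ∫ s, φ s = √(2 * π) * (r / c) := by
      rw [hφ', integral_sub_right_eq_self (fun x => exp (-(c ^ 2 / (2 * r ^ 2)) * x ^ 2)),
        integral_gaussian, ← Real.sqrt_sq (div_pos hr hc).le, ← Real.sqrt_mul (by positivity)]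
      congr 1
      field_simp
    have : J ≤ √(2 * π) * (r / c) :=
      htot ▸ setIntegral_le_integral hint' (ae_of_all _ fun s => (exp_pos _).le)
    calc c * J ≤ c * (√(2 * π) * (r / c)) := by gcongr
      _ = √(2 * π) * r := by field_simp
  rw [← div_eq_mul_inv, le_div_iff₀ (by positivity)]
  linarith

theorem stmt_8 (γ : ℝ) (hγ1 : -3 < γ) (hγ2 : γ ≤ 1) :
    ∃ C : ℝ, 0 < C ∧ ∀ v : EuclideanSpace ℝ (Fin 3),
      (∫ η : EuclideanSpace ℝ (Fin 3),
          ‖v - η‖ ^ (-(3 - γ) / 2) * Real.exp (-‖v - η‖ ^ 2 / 8)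
            * Real.exp (-(‖v‖ ^ 2 - ‖η‖ ^ 2) ^ 2 / (8 * ‖v - η‖ ^ 2)))
        ≤ C * (1 + ‖v‖)⁻¹ := by
  set p : ℝ := -(3 - γ) / 2 with hp
  set M : ℝ := ∫ r in Set.Ioi (0 : ℝ), r ^ (p + 2) * exp (-(1 / 8) * r ^ 2) with hM
  have hM_int : IntegrableOn (fun r : ℝ => r ^ (p + 2) * exp (-(1 / 8) * r ^ 2)) (Set.Ioi 0) :=
    integrableOn_rpow_mul_exp_neg_mul_sq (by norm_num) (by rw [hp]; linarith)
  have hM_nonneg : 0 ≤ M := setIntegral_nonneg measurableSet_Ioi fun r hr => by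
    have : 0 < r := hr
    positivity
  refine ⟨2 * π * ((2 + √(2 * π)) * (M + 1)), by positivity, fun v => ?_⟩
  obtain ⟨b, hb⟩ := exists_orthonormalBasis_norm_smul v
  set c := ‖v‖ with hc
  have hc0 : 0 ≤ c := norm_nonneg v
  set K : ℝ → ℝ → ℝ := fun s r =>
    r ^ p * exp (-r ^ 2 / 8) * exp (-(2 * (c * s) - r ^ 2) ^ 2 / (8 * r ^ 2)) with hK
  have hK_meas : Measurable fun q : ℝ × ℝ => ENNReal.ofReal (K q.1 q.2) := by
    simp only [hK]
    fun_prop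
  have hsub : ∀ η, ‖v - η‖ ^ p * exp (-‖v - η‖ ^ 2 / 8)
      * exp (-(c ^ 2 - ‖η‖ ^ 2) ^ 2 / (8 * ‖v - η‖ ^ 2)) = K (inner ℝ (b 0) (v - η)) ‖v - η‖ := by
    intro η
    have h1 : c * inner ℝ (b 0) (v - η) = inner ℝ v (v - η) := by
      conv_rhs => rw [hb, real_inner_smul_left]
      rw [← hb]
    have h2 : ‖η‖ ^ 2 = c ^ 2 - 2 * inner ℝ v (v - η) + ‖v - η‖ ^ 2 := by
      rw [hc, ← norm_sub_sq_real, sub_sub_cancel]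
    simp only [hK]
    rw [h1, h2]
    congr 4
    ring
  simp_rw [hsub]
  have hnn : ∀ s r, 0 ≤ r → 0 ≤ K s r := fun s r hr => by positivity
  have hmeas : Measurable fun η : EuclideanSpace ℝ (Fin 3) =>
      K (inner ℝ (b 0) (v - η)) ‖v - η‖ := by
    simp only [hK]
    fun_prop
  rw [integral_eq_lintegral_of_nonneg_ae (ae_of_all _ fun η => hnn _ _ (norm_nonneg _))
    hmeas.aestronglyMeasurable]
  refine ENNReal.toReal_le_of_le_ofReal (by positivity) ?_
  rw [lintegral_sub_left_eq_self
    (fun u : EuclideanSpace ℝ (Fin 3) => ENNReal.ofReal (K (inner ℝ (b 0) u) ‖u‖)) v]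
  calc
    _ ≤ ENNReal.ofReal (2 * π) * ∫⁻ r in Set.Ioi (0 : ℝ),
          ENNReal.ofReal r * ∫⁻ s in Set.Ioo (-r) r, ENNReal.ofReal (K s r) :=
      lintegral_inner_norm_le b (F := fun s r => ENNReal.ofReal (K s r)) hK_meas
    _ ≤ ENNReal.ofReal (2 * π) * ∫⁻ r in Set.Ioi (0 : ℝ),
          ENNReal.ofReal ((2 + √(2 * π)) * (1 + c)⁻¹) *
            ENNReal.ofReal (r ^ (p + 2) * exp (-(1 / 8) * r ^ 2)) := by
      refine mul_le_mul_right (setLIntegral_mono' measurableSet_Ioi fun r hr => ?_) _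
      have hr : 0 < r := hr
      have hA : 0 ≤ r ^ p * exp (-r ^ 2 / 8) := by positivity
      simp only [hK, ENNReal.ofReal_mul hA]
      rw [lintegral_const_mul' _ _ ENNReal.ofReal_ne_top]
      refine (mul_le_mul_right (mul_le_mul_right (lintegral_Ioo_exp_neg_sq_le hc0 hr) _) _).trans
        (le_of_eq ?_)
      rw [← ENNReal.ofReal_mul hA, ← ENNReal.ofReal_mul hr.le,
        ← ENNReal.ofReal_mul (by positivity), rpow_add hr, rpow_two,
        show -(1 / 8) * r ^ 2 = -r ^ 2 / 8 by ring]
      congr 1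
      ring
    _ = ENNReal.ofReal (2 * π * ((2 + √(2 * π)) * M) * (1 + c)⁻¹) := by
      rw [lintegral_const_mul' _ _ ENNReal.ofReal_ne_top, ← ofReal_integral_eq_lintegral_ofReal hM_int
        ((ae_restrict_mem measurableSet_Ioi).mono fun r hr => ?_), ← hM,
        ← ENNReal.ofReal_mul (by positivity), ← ENNReal.ofReal_mul (by positivity)]
      · congr 1
        ring
      · have : 0 < r := hr
        simp only [Pi.zero_apply]
        positivity
    _ ≤ _ := by
      gcongr
      linarith
end
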